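/- Let K ∈ ℝ^{m×n} and let P be a symmetric n×n real matrix satisfying P = (A + BK)ᵀ P (A + BK) + [I;K]ᵀ Q [I;K], with Q_uu + BᵀPB invertible, and set K^N = K(P). Then the Riccati residual satisfies R(P) = -(K - K^N)ᵀ (Q_uu + BᵀPB) (K - K^N). In particular, if Q_uu + BᵀPB is positive semidefinite then -R(P) is positive semidefinite. -/

import Mathlib

open Matrix

/-- The LQR gain operator `K(P) = -(Q_uu + BᵀPB)⁻¹ (Q_ux + BᵀPA)`. -/
noncomputable def gainK {n m : ℕ} (A : Matrix (Fin n) (Fin n) ℝ) (B : Matrix (Fin n) (Fin m) ℝ)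
    (Qux : Matrix (Fin m) (Fin n) ℝ) (Quu : Matrix (Fin m) (Fin m) ℝ)
    (P : Matrix (Fin n) (Fin n) ℝ) : Matrix (Fin m) (Fin n) ℝ :=
  -(Quu + Bᵀ * P * B)⁻¹ * (Qux + Bᵀ * P * A)

/-- The stacked matrix `[I; K] ∈ ℝ^{(n+m)×n}`. -/
def stackIK {n m : ℕ} (K : Matrix (Fin m) (Fin n) ℝ) : Matrix (Fin n ⊕ Fin m) (Fin n) ℝ :=
  fromRows (1 : Matrix (Fin n) (Fin n) ℝ) K

/-- The Riccati operator
`R(P) = -P + Q_xx + AᵀPA - (Q_xu + AᵀPB)(Q_uu + BᵀPB)⁻¹(Q_ux + BᵀPA)`. -/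
noncomputable def Ricc {n m : ℕ} (A : Matrix (Fin n) (Fin n) ℝ) (B : Matrix (Fin n) (Fin m) ℝ)
    (Qxx : Matrix (Fin n) (Fin n) ℝ) (Qxu : Matrix (Fin n) (Fin m) ℝ)
    (Qux : Matrix (Fin m) (Fin n) ℝ) (Quu : Matrix (Fin m) (Fin m) ℝ)
    (P : Matrix (Fin n) (Fin n) ℝ) : Matrix (Fin n) (Fin n) ℝ :=
  -P + Qxx + Aᵀ * P * A -
    (Qxu + Aᵀ * P * B) * (Quu + Bᵀ * P * B)⁻¹ * (Qux + Bᵀ * P * A)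

/-- Completing the square for a quadratic form with a symmetric invertible leading block. -/
theorem transpose_add_inv_mul_mul_self {n m : ℕ} {S : Matrix (Fin m) (Fin m) ℝ}
    (hS : Sᵀ = S) (hu : IsUnit S) (K L : Matrix (Fin m) (Fin n) ℝ) :
    (K + S⁻¹ * L)ᵀ * S * (K + S⁻¹ * L) = Kᵀ * S * K + Kᵀ * L + Lᵀ * K + Lᵀ * S⁻¹ * L := by
  have hdet : IsUnit S.det := (isUnit_iff_isUnit_det S).mp hu
  have hleft : (K + S⁻¹ * L)ᵀ * S = Kᵀ * S + Lᵀ := by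
    rw [transpose_add, transpose_mul, transpose_nonsing_inv, hS, Matrix.add_mul,
      Matrix.mul_assoc Lᵀ, nonsing_inv_mul S hdet, Matrix.mul_one]
  rw [hleft, Matrix.add_mul, Matrix.mul_add, Matrix.mul_add, Matrix.mul_assoc Kᵀ S (S⁻¹ * L),
    mul_nonsing_inv_cancel_left S L hdet, Matrix.mul_assoc Lᵀ S⁻¹ L]
  abel

/-- The quadratic form of a block matrix evaluated at the stacked matrix `[I; K]`. -/
theorem stackIK_transpose_mul_fromBlocks_mul {n m : ℕ}
    (Qxx : Matrix (Fin n) (Fin n) ℝ) (Qxu : Matrix (Fin n) (Fin m) ℝ)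
    (Qux : Matrix (Fin m) (Fin n) ℝ) (Quu : Matrix (Fin m) (Fin m) ℝ)
    (K : Matrix (Fin m) (Fin n) ℝ) :
    (stackIK K)ᵀ * fromBlocks Qxx Qxu Qux Quu * stackIK K =
      Qxx + Kᵀ * Qux + Qxu * K + Kᵀ * Quu * K := by
  rw [stackIK, transpose_fromRows, transpose_one, fromCols_mul_fromBlocks, fromCols_mul_fromRows]
  simp only [Matrix.one_mul, Matrix.mul_one, Matrix.add_mul]
  abel

/-- if `P` solves the policy-evaluation Lyapunov equation for `K` and `K^N = K(P)`,
then `R(P) = -(K - K^N)ᵀ (Q_uu + BᵀPB) (K - K^N)`; in particular if `Q_uu + BᵀPB ⪰ 0` then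
`-R(P) ⪰ 0`. -/
theorem stmt8 {n m : ℕ}
    (A : Matrix (Fin n) (Fin n) ℝ) (B : Matrix (Fin n) (Fin m) ℝ)
    (Qxx : Matrix (Fin n) (Fin n) ℝ) (Qxu : Matrix (Fin n) (Fin m) ℝ)
    (Quu : Matrix (Fin m) (Fin m) ℝ)
    (hQxx : Qxxᵀ = Qxx) (hQuu : Quuᵀ = Quu)
    (Q : Matrix (Fin n ⊕ Fin m) (Fin n ⊕ Fin m) ℝ)
    (hQ : Q = fromBlocks Qxx Qxu Qxuᵀ Quu)
    (K : Matrix (Fin m) (Fin n) ℝ)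
    (P : Matrix (Fin n) (Fin n) ℝ) (hP : Pᵀ = P)
    (hLyap : P = (A + B * K)ᵀ * P * (A + B * K) + (stackIK K)ᵀ * Q * stackIK K)
    (hinv : IsUnit (Quu + Bᵀ * P * B))
    (KN : Matrix (Fin m) (Fin n) ℝ) (hKN : KN = gainK A B Qxuᵀ Quu P) :
    Ricc A B Qxx Qxu Qxuᵀ Quu P = -((K - KN)ᵀ * (Quu + Bᵀ * P * B) * (K - KN)) ∧
      ((Quu + Bᵀ * P * B).PosSemidef → (-(Ricc A B Qxx Qxu Qxuᵀ Quu P)).PosSemidef) := by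
  have hS : (Quu + Bᵀ * P * B)ᵀ = Quu + Bᵀ * P * B := by
    simp [hQuu, hP, Matrix.mul_assoc]
  have hL : (Qxuᵀ + Bᵀ * P * A)ᵀ = Qxu + Aᵀ * P * B := by
    simp [hP, Matrix.mul_assoc]
  have hres : Ricc A B Qxx Qxu Qxuᵀ Quu P =
      -((K - KN)ᵀ * (Quu + Bᵀ * P * B) * (K - KN)) := by
    rw [hQ, stackIK_transpose_mul_fromBlocks_mul] at hLyap
    have hsub : K - KN = K + (Quu + Bᵀ * P * B)⁻¹ * (Qxuᵀ + Bᵀ * P * A) := by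
      rw [hKN, gainK, Matrix.neg_mul, sub_neg_eq_add]
    have hP' : P = Qxx + Aᵀ * P * A + Kᵀ * (Quu + Bᵀ * P * B) * K +
        Kᵀ * (Qxuᵀ + Bᵀ * P * A) + (Qxu + Aᵀ * P * B) * K := by
      refine hLyap.trans ?_
      simp only [transpose_add, transpose_mul, Matrix.add_mul, Matrix.mul_add, Matrix.mul_assoc]
      abel
    rw [hsub, transpose_add_inv_mul_mul_self hS hinv, hL, Ricc]
    linear_combination (norm := abel) -hP'
  refine ⟨hres, fun hpsd => ?_⟩
  rw [hres, neg_neg, ← conjTranspose_eq_transpose_of_trivial]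
  exact hpsd.conjTranspose_mul_mul_same (K - KN)
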